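/- Let E be a Riesz space with point separating order dual E^~. The Arens homomorphism m : Z(E)'' → L_b(E^~), defined by m(F)(f) = F∘f, is a unital algebra homomorphism and an order continuous lattice homomorphism, and its range is contained in the ideal center Z(E^~) of E^~. -/

import Mathlib

noncomputable section

open Set

/-- A map between preordered sets is *order bounded* if it maps order intervals into
order intervals. -/
def IsOrdBdd {E F : Type*} [Preorder E] [Preorder F] (f : E → F) : Prop :=
  ∀ a b : E, ∃ c d : F, ∀ x : E, a ≤ x → x ≤ b → c ≤ f x ∧ f x ≤ d

/-- A map of a Riesz space is *band preserving* if it preserves disjointness. -/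
def IsBandPres {E : Type*} [Lattice E] [AddCommGroup E] (T : E → E) : Prop :=
  ∀ x y : E, |x| ⊓ |y| = 0 → |T x| ⊓ |y| = 0

/-- An *orthomorphism*: an order bounded, band preserving linear map. -/
def IsOrtho {E : Type*} [Lattice E] [AddCommGroup E] [Module ℝ E] (T : E → E) : Prop :=
  IsLinearMap ℝ T ∧ IsOrdBdd T ∧ IsBandPres T

/-- A member of the *ideal center* `Z(E)`: an orthomorphism dominated by a multiple of the
identity. -/
def IsCentral {E : Type*} [Lattice E] [AddCommGroup E] [Module ℝ E] (T : E → E) : Prop :=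
  IsOrtho T ∧ ∃ c : ℝ, ∀ x : E, 0 ≤ x → -(c • x) ≤ T x ∧ T x ≤ c • x

/-- Order continuity of a real functional: it converges to `0` along every downward
directed system with infimum `0`. -/
def IsOrderContinuousFun {X : Type*} [Lattice X] [AddCommGroup X] (φ : X → ℝ) : Prop :=
  ∀ s : Set X, s.Nonempty → DirectedOn (· ≥ ·) s → IsGLB s 0 →
    ∀ ε : ℝ, 0 < ε → ∃ x ∈ s, ∀ y ∈ s, y ≤ x → |φ y| < ε

/-- `p` realizes the Riesz space `D` as the order dual `E^∼` of `E`. -/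
structure IsOrderDual (E D : Type*) [Lattice E] [AddCommGroup E] [Module ℝ E]
    [Lattice D] [AddCommGroup D] [Module ℝ D] (p : D → E → ℝ) : Prop where
  lin_fun : ∀ f : D, IsLinearMap ℝ (p f)
  lin_vec : ∀ x : E, IsLinearMap ℝ fun f => p f x
  bdd : ∀ f : D, IsOrdBdd (p f)
  inj : ∀ f g : D, (∀ x, p f x = p g x) → f = g
  surj : ∀ φ : E → ℝ, IsLinearMap ℝ φ → IsOrdBdd φ → ∃ f : D, ∀ x, p f x = φ x
  le_iff : ∀ f g : D, f ≤ g ↔ ∀ x : E, 0 ≤ x → p f x ≤ p g x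

/-- `p` realizes the Riesz space `B` as the order continuous order dual `(X^∼)ₙ` of `X`
(used for `X = A^∼`, giving `B = (A^∼)ₙ^∼`). -/
structure IsOrderContinuousDual (X B : Type*) [Lattice X] [AddCommGroup X] [Module ℝ X]
    [Lattice B] [AddCommGroup B] [Module ℝ B] (p : B → X → ℝ) : Prop where
  lin_fun : ∀ F : B, IsLinearMap ℝ (p F)
  lin_vec : ∀ f : X, IsLinearMap ℝ fun F => p F f
  bdd : ∀ F : B, IsOrdBdd (p F)
  cont : ∀ F : B, IsOrderContinuousFun (p F)
  inj : ∀ F G : B, (∀ f, p F f = p G f) → F = G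
  surj : ∀ φ : X → ℝ, IsLinearMap ℝ φ → IsOrdBdd φ → IsOrderContinuousFun φ →
    ∃ F : B, ∀ f, p F f = φ f
  le_iff : ∀ F G : B, F ≤ G ↔ ∀ f : X, 0 ≤ f → p F f ≤ p G f

/-- `ρ` realizes the lattice-ordered algebra `O` as the `f`-algebra `Orth(E)` of all
orthomorphisms of `E`. -/
structure IsOrthAlg (E O : Type*) [Lattice E] [AddCommGroup E] [Module ℝ E]
    [Lattice O] [Ring O] [Module ℝ O] (ρ : O → E → E) : Prop where
  ortho : ∀ a : O, IsOrtho (ρ a)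
  lin_vec : ∀ x : E, IsLinearMap ℝ fun a => ρ a x
  map_one : ∀ x : E, ρ 1 x = x
  map_mul : ∀ (a b : O) (x : E), ρ (a * b) x = ρ a (ρ b x)
  inj : ∀ a b : O, (∀ x, ρ a x = ρ b x) → a = b
  surj : ∀ T : E → E, IsOrtho T → ∃ a : O, ∀ x, ρ a x = T x
  le_iff : ∀ a b : O, a ≤ b ↔ ∀ x : E, 0 ≤ x → ρ a x ≤ ρ b x

/-- `ρ` realizes the normed lattice-ordered algebra `Z` as the ideal center `Z(E)` of `E`,
an AM-space whose norm is the order unit norm (the order/algebra unit being `id`). -/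
structure IsCenterOf (E Z : Type*) [Lattice E] [AddCommGroup E] [Module ℝ E]
    [Lattice Z] [NormedRing Z] [NormedAlgebra ℝ Z] (ρ : Z → E → E) : Prop where
  central : ∀ a : Z, IsCentral (ρ a)
  lin_vec : ∀ x : E, IsLinearMap ℝ fun a => ρ a x
  map_one : ∀ x : E, ρ 1 x = x
  map_mul : ∀ (a b : Z) (x : E), ρ (a * b) x = ρ a (ρ b x)
  inj : ∀ a b : Z, (∀ x, ρ a x = ρ b x) → a = b
  surj : ∀ T : E → E, IsCentral T → ∃ a : Z, ∀ x, ρ a x = T x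
  le_iff : ∀ a b : Z, a ≤ b ↔ ∀ x : E, 0 ≤ x → ρ a x ≤ ρ b x
  norm_le_iff : ∀ (a : Z) (c : ℝ), 0 ≤ c →
    (‖a‖ ≤ c ↔ ∀ x : E, 0 ≤ x → -(c • x) ≤ ρ a x ∧ ρ a x ≤ c • x)

/-- The pairing `p : D → E → ℝ` separates the points of `E`. -/
def SepPoints {E D : Type*} [Zero E] (p : D → E → ℝ) : Prop :=
  ∀ x : E, (∀ f : D, p f x = 0) → x = 0

/-- `y` belongs to the `σ(E,D)`-closure of `s ⊆ E`, for the pairing `p : D → E → ℝ`. -/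
def InWeakClosure {E D : Type*} (p : D → E → ℝ) (s : Set E) (y : E) : Prop :=
  ∀ (fs : Finset D) (ε : ℝ), 0 < ε → ∃ z ∈ s, ∀ f ∈ fs, |p f z - p f y| < ε

/-- `E` has a *topologically full center*: for each `x ∈ E₊` the `σ(E,E^∼)`-closure of
`Z(E)x` contains the order ideal generated by `x`.  Here `p : D → E → ℝ` is the duality
with `E^∼` and `ρ : Z → E → E` is the action of the ideal center. -/
def TopFullCenter {E D Z : Type*} [Lattice E] [AddCommGroup E] [Module ℝ E]
    (p : D → E → ℝ) (ρ : Z → E → E) : Prop :=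
  ∀ x : E, 0 ≤ x → ∀ y : E, (∃ c : ℝ, 0 ≤ c ∧ |y| ≤ c • x) →
    InWeakClosure p {z | ∃ T : Z, ρ T x = z} y

/-- `FG` is the Arens product `F ⬝ G` in the order bidual `B` of the algebra `A`:
`(F⬝G)(f) = F(G⬝f)`, `(G⬝f)(a) = G(f⬝a)`, `(f⬝a)(b) = f(ab)`; `pA : DA → A → ℝ` is the
duality of `A` with `A^∼` and `pB : B → DA → ℝ` that of `(A^∼)ₙ^∼` with `A^∼`. -/
def IsArensProduct {A DA B : Type*} [Mul A] (pA : DA → A → ℝ) (pB : B → DA → ℝ)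
    (F G FG : B) : Prop :=
  ∀ f Gf : DA,
    (∀ (a : A) (fa : DA), (∀ b : A, pA fa b = pA f (a * b)) → pA Gf a = pB G fa) →
    pB FG f = pB F Gf

/-- The ring structure of `B` is the Arens multiplication inherited from `A`, with unit the
canonical image of `1 ∈ A`. -/
structure IsArensAlgebra {A DA B : Type*} [Monoid A] [Ring B]
    (pA : DA → A → ℝ) (pB : B → DA → ℝ) : Prop where
  mul_def : ∀ F G : B, IsArensProduct pA pB F G (F * G)
  one_def : ∀ f : DA, pB 1 f = pA f 1

section NormedArens

variable (Z : Type*) [NormedRing Z] [NormedAlgebra ℝ Z]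

/-- First step of the Arens construction: `f ⬝ a` for `f ∈ Z'`, `a ∈ Z`:
`(f⬝a)(b) = f(ab)`. -/
def arensDot (f : Z →L[ℝ] ℝ) (a : Z) : Z →L[ℝ] ℝ :=
  f.comp (ContinuousLinearMap.mul ℝ Z a)

/-- `a ↦ f ⬝ a` as a continuous linear map. -/
def arensDotL (f : Z →L[ℝ] ℝ) : Z →L[ℝ] Z →L[ℝ] ℝ :=
  (ContinuousLinearMap.compL ℝ Z Z ℝ f).comp (ContinuousLinearMap.mul ℝ Z)

/-- Second step of the Arens construction: `F ⬝ f` for `F ∈ Z''`, `f ∈ Z'`: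
`(F⬝f)(a) = F(f⬝a)`. -/
def arensFDot (F : (Z →L[ℝ] ℝ) →L[ℝ] ℝ) (f : Z →L[ℝ] ℝ) : Z →L[ℝ] ℝ :=
  F.comp (arensDotL Z f)

/-- `f ↦ f ⬝ ·` as a continuous linear map. -/
def arensDotLL : (Z →L[ℝ] ℝ) →L[ℝ] Z →L[ℝ] Z →L[ℝ] ℝ :=
  ((ContinuousLinearMap.compL ℝ Z (Z →L[ℝ] Z) (Z →L[ℝ] ℝ)).flip
      (ContinuousLinearMap.mul ℝ Z)).comp (ContinuousLinearMap.compL ℝ Z Z ℝ)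

/-- `f ↦ F ⬝ f` as a continuous linear map. -/
def arensFDotL (F : (Z →L[ℝ] ℝ) →L[ℝ] ℝ) : (Z →L[ℝ] ℝ) →L[ℝ] Z →L[ℝ] ℝ :=
  (ContinuousLinearMap.compL ℝ Z (Z →L[ℝ] ℝ) ℝ F).comp (arensDotLL Z)

/-- The *Arens product* on the norm bidual `Z''`: `(F⬝G)(f) = F(G⬝f)`. -/
def arensMul (F G : (Z →L[ℝ] ℝ) →L[ℝ] ℝ) : (Z →L[ℝ] ℝ) →L[ℝ] ℝ :=
  F.comp (arensFDotL Z G)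

/-- The canonical image of `1 ∈ Z` in the bidual `Z''`; it is the unit for the Arens
product. -/
def arensOne : (Z →L[ℝ] ℝ) →L[ℝ] ℝ := ContinuousLinearMap.apply ℝ ℝ (1 : Z)

end NormedArens

section DualOrder

variable {Z : Type*} [Lattice Z] [NormedRing Z] [NormedAlgebra ℝ Z]

/-- Positivity of a functional in `Z'`. -/
def dualNonneg (μ : Z →L[ℝ] ℝ) : Prop := ∀ a : Z, 0 ≤ a → 0 ≤ μ a

/-- The canonical order of the bidual `Z''`. -/
def bidualLe (F G : (Z →L[ℝ] ℝ) →L[ℝ] ℝ) : Prop :=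
  ∀ μ : Z →L[ℝ] ℝ, dualNonneg μ → F μ ≤ G μ

/-- `H = F ⊔ G` in the bidual `Z''`. -/
def IsBidualSup (F G H : (Z →L[ℝ] ℝ) →L[ℝ] ℝ) : Prop :=
  bidualLe F H ∧ bidualLe G H ∧
    ∀ K : (Z →L[ℝ] ℝ) →L[ℝ] ℝ, bidualLe F K → bidualLe G K → bidualLe H K

/-- `s ⊆ Z''` is downward directed with infimum `0`. -/
def BidualDownTo0 (s : Set ((Z →L[ℝ] ℝ) →L[ℝ] ℝ)) : Prop :=
  s.Nonempty ∧ (∀ F ∈ s, ∀ G ∈ s, ∃ H ∈ s, bidualLe H F ∧ bidualLe H G) ∧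
    (∀ F ∈ s, bidualLe 0 F) ∧ ∀ K, (∀ F ∈ s, bidualLe K F) → bidualLe K 0

/-- The Riesz–Kantorovich formula for `|μ|(a)`, `μ ∈ Z'`, `a ∈ Z₊`. -/
def dualAbs (μ : Z →L[ℝ] ℝ) (a : Z) : ℝ := sSup ((fun b => μ b) '' {b : Z | |b| ≤ a})

/-- Disjointness `|μ| ⊓ |ν| = 0` in `Z'`. -/
def DualDisjoint (μ ν : Z →L[ℝ] ℝ) : Prop :=
  ∀ a : Z, 0 ≤ a → ∀ ε : ℝ, 0 < ε →
    ∃ b c : Z, 0 ≤ b ∧ 0 ≤ c ∧ b + c = a ∧ dualAbs μ b + dualAbs ν c < ε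

/-- The Riesz–Kantorovich formula for `|F|(μ)`, `F ∈ Z''`, `μ ∈ Z'₊`. -/
def bidualAbs (F : (Z →L[ℝ] ℝ) →L[ℝ] ℝ) (μ : Z →L[ℝ] ℝ) : ℝ :=
  sSup ((fun ν => F ν) '' {ν : Z →L[ℝ] ℝ | ∀ a : Z, 0 ≤ a → dualAbs ν a ≤ μ a})

/-- Disjointness `|F| ⊓ |G| = 0` in `Z''`. -/
def BidualDisjoint (F G : (Z →L[ℝ] ℝ) →L[ℝ] ℝ) : Prop :=
  ∀ μ : Z →L[ℝ] ℝ, dualNonneg μ → ∀ ε : ℝ, 0 < ε →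
    ∃ μ₁ μ₂ : Z →L[ℝ] ℝ, dualNonneg μ₁ ∧ dualNonneg μ₂ ∧ μ₁ + μ₂ = μ ∧
      bidualAbs F μ₁ + bidualAbs G μ₂ < ε

end DualOrder

/-- A member of the ideal center `Z(J)` of an order ideal `J` of a Riesz space, encoded as a
map defined on the ambient space whose restriction to `J` is the actual operator. -/
def IsCentralOn {D : Type*} [Lattice D] [AddCommGroup D] [Module ℝ D]
    (J : Set D) (S : D → D) : Prop :=
  (∀ f ∈ J, S f ∈ J) ∧ (∀ f ∈ J, ∀ g ∈ J, S (f + g) = S f + S g) ∧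
    (∀ (c : ℝ), ∀ f ∈ J, S (c • f) = c • S f) ∧
    ∃ c : ℝ, ∀ f ∈ J, 0 ≤ f → -(c • f) ≤ S f ∧ S f ≤ c • f

end

/-- A cone `R` in `V × ℝ` that lies above `0` over the origin and meets every vertical line is
bounded below by the graph of a linear functional. -/
theorem exists_linearMap_le_of_cone {V : Type*} [AddCommGroup V] [Module ℝ V] (R : V → ℝ → Prop)
    (hadd : ∀ v w r t, R v r → R w t → R (v + w) (r + t))
    (hsmul : ∀ c : ℝ, 0 < c → ∀ v r, R v r → R (c • v) (c * r))
    (hne : ∀ v, ∃ r, R v r) (h0 : ∀ r, R 0 r → 0 ≤ r) :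
    ∃ K : V →ₗ[ℝ] ℝ, ∀ v r, R v r → K v ≤ r := by
  have hbdd : ∀ v, BddBelow {r | R v r} := fun v => by
    obtain ⟨t, ht⟩ := hne (-v)
    refine ⟨-t, fun r hr => ?_⟩
    have := h0 (r + t) (by simpa using hadd _ _ _ _ hr ht)
    linarith
  have hle : ∀ c : ℝ, 0 < c → ∀ v, sInf {r | R (c • v) r} ≤ c * sInf {r | R v r} := by
    intro c hc v
    rw [← div_le_iff₀' hc]
    refine le_csInf (hne v) fun r hr => ?_
    rw [div_le_iff₀' hc]
    exact csInf_le (hbdd _) (hsmul c hc v r hr)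
  obtain ⟨K, -, hK⟩ := exists_extension_of_le_sublinear (⟨⊥, 0⟩ : V →ₗ.[ℝ] ℝ)
    (fun v => sInf {r | R v r})
    (fun c hc v => by
      refine le_antisymm (hle c hc v) ?_
      have := hle c⁻¹ (inv_pos.2 hc) (c • v)
      rw [inv_smul_smul₀ hc.ne', ← div_eq_inv_mul, le_div_iff₀' hc] at this
      exact this)
    (fun v w => by
      rw [← sub_le_iff_le_add]
      refine le_csInf (hne v) fun r hr => ?_
      rw [sub_le_comm]
      refine le_csInf (hne w) fun t ht => ?_
      rw [sub_le_iff_le_add']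
      exact csInf_le (hbdd _) (hadd _ _ _ _ hr ht))
    (fun ⟨x, hx⟩ => by
      obtain rfl : x = 0 := by simpa using hx
      exact le_csInf (hne 0) h0)
  exact ⟨K, fun v r hr => (hK v).trans (csInf_le (hbdd v) hr)⟩

section ArensApply

variable {Z : Type*} [NormedRing Z] [NormedAlgebra ℝ Z]

@[simp] theorem arensMul_apply_apply (F G : (Z →L[ℝ] ℝ) →L[ℝ] ℝ) (ξ : Z →L[ℝ] ℝ) :
    arensMul Z F G ξ = F (arensFDot Z G ξ) := rfl

@[simp] theorem arensFDot_apply (G : (Z →L[ℝ] ℝ) →L[ℝ] ℝ) (ξ : Z →L[ℝ] ℝ) (a : Z) :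
    arensFDot Z G ξ a = G (arensDot Z ξ a) := rfl

@[simp] theorem arensDot_apply (ξ : Z →L[ℝ] ℝ) (a b : Z) :
    arensDot Z ξ a b = ξ (a * b) := rfl

end ArensApply

theorem dualNonneg.mono {Z : Type*} [Lattice Z] [NormedRing Z] [NormedAlgebra ℝ Z]
    [IsOrderedAddMonoid Z] {ξ : Z →L[ℝ] ℝ} (hξ : dualNonneg ξ) {a b : Z} (hab : a ≤ b) :
    ξ a ≤ ξ b := by
  have := hξ (b - a) (sub_nonneg.2 hab)
  rwa [map_sub, sub_nonneg] at this

/-- A normed algebra whose norm is the order unit norm of its unit element and in which products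
of positive elements are positive. -/
structure IsOrderUnitAlgebra (Z : Type*) [Lattice Z] [NormedRing Z] [NormedAlgebra ℝ Z] :
    Prop where
  norm_le_iff : ∀ (a : Z) (c : ℝ), 0 ≤ c → (‖a‖ ≤ c ↔ -(c • (1 : Z)) ≤ a ∧ a ≤ c • (1 : Z))
  nonneg_mul : ∀ a b : Z, 0 ≤ a → 0 ≤ b → 0 ≤ a * b
  one_nonneg : (0 : Z) ≤ 1

namespace IsOrderUnitAlgebra

variable {Z : Type*} [Lattice Z] [NormedRing Z] [NormedAlgebra ℝ Z]

theorem le_norm_smul_one (h : IsOrderUnitAlgebra Z) (a : Z) : a ≤ ‖a‖ • (1 : Z) :=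
  ((h.norm_le_iff a _ (norm_nonneg a)).1 le_rfl).2

theorem neg_norm_smul_one_le (h : IsOrderUnitAlgebra Z) (a : Z) : -(‖a‖ • (1 : Z)) ≤ a :=
  ((h.norm_le_iff a _ (norm_nonneg a)).1 le_rfl).1

theorem dualNonneg_arensDot (h : IsOrderUnitAlgebra Z) {ξ : Z →L[ℝ] ℝ} (hξ : dualNonneg ξ)
    {a : Z} (ha : 0 ≤ a) : dualNonneg (arensDot Z ξ a) := fun b hb =>
  hξ _ (h.nonneg_mul a b ha hb)

/-- The states of an order unit algebra, with the weak-star topology. -/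
def states (Z : Type*) [Lattice Z] [NormedRing Z] [NormedAlgebra ℝ Z] : Set (WeakDual ℝ Z) :=
  {φ | (∀ a : Z, 0 ≤ a → 0 ≤ φ a) ∧ φ 1 = 1}

theorem convex_states : Convex ℝ (states Z) := by
  rintro φ ⟨hφ, hφ1⟩ ψ ⟨hψ, hψ1⟩ s t hs ht hst
  refine ⟨fun a ha => ?_, ?_⟩
  · exact add_nonneg (mul_nonneg hs (hφ a ha)) (mul_nonneg ht (hψ a ha))
  · change s * φ 1 + t * ψ 1 = 1
    rw [hφ1, hψ1, mul_one, mul_one, hst]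

variable [IsOrderedAddMonoid Z]

theorem norm_le_apply_one (h : IsOrderUnitAlgebra Z) {ξ : Z →L[ℝ] ℝ} (hξ : dualNonneg ξ) :
    ‖ξ‖ ≤ ξ 1 := by
  refine ξ.opNorm_le_bound (hξ 1 h.one_nonneg) fun a => ?_
  have h1 := hξ.mono (h.le_norm_smul_one a)
  have h2 := hξ.mono (h.neg_norm_smul_one_le a)
  simp only [map_neg, map_smul, smul_eq_mul] at h1 h2
  rw [Real.norm_eq_abs, abs_le]
  constructor <;> linarith

theorem bidual_apply_le (h : IsOrderUnitAlgebra Z) (F : (Z →L[ℝ] ℝ) →L[ℝ] ℝ) {ξ : Z →L[ℝ] ℝ}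
    (hξ : dualNonneg ξ) : |F ξ| ≤ ‖F‖ * ξ 1 :=
  (F.le_opNorm ξ).trans (mul_le_mul_of_nonneg_left (h.norm_le_apply_one hξ) (norm_nonneg F))

/-- Positive elements of the bidual with infimum `0` have Arens product `0`. -/
theorem arensMul_apply_eq_zero (h : IsOrderUnitAlgebra Z) {P Q : (Z →L[ℝ] ℝ) →L[ℝ] ℝ}
    (hP : bidualLe 0 P) (hQ : bidualLe 0 Q)
    (hPQ : ∀ K, bidualLe K P → bidualLe K Q → bidualLe K 0) {ξ : Z →L[ℝ] ℝ}
    (hξ : dualNonneg ξ) : arensMul Z P Q ξ = 0 := by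
  have hdot : ∀ {ξ : Z →L[ℝ] ℝ}, dualNonneg ξ → dualNonneg (arensFDot Z Q ξ) :=
    fun hξ a ha => hQ _ (h.dualNonneg_arensDot hξ ha)
  have hone : ∀ ξ : Z →L[ℝ] ℝ, arensDot Z ξ 1 = ξ := fun ξ => by
    ext b; simp
  set c : ℝ := 1 + ‖P‖ + ‖Q‖ with hc
  have hcpos : 0 < c := by positivity
  have hPc : ‖P‖ ≤ c := by linarith [norm_nonneg Q]
  have hQc : ‖Q‖ ≤ c := by linarith [norm_nonneg P]
  have hle := hPQ (c⁻¹ • arensMul Z P Q)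
    (fun ξ hξ => by
      rw [smul_apply, smul_eq_mul, inv_mul_le_iff₀ hcpos]
      have : 0 ≤ P (c • ξ - arensFDot Z Q ξ) := hP _ fun a ha => by
        have h1 := (le_abs_self _).trans (h.bidual_apply_le Q (h.dualNonneg_arensDot hξ ha))
        rw [arensDot_apply, mul_one] at h1
        have h2 := mul_le_mul_of_nonneg_right hQc (hξ a ha)
        simp only [sub_apply, smul_apply, smul_eq_mul,
          arensFDot_apply]
        linarith
      simpa using this)
    (fun ξ hξ => by
      rw [smul_apply, smul_eq_mul, inv_mul_le_iff₀ hcpos]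
      have h1 := (le_abs_self _).trans (h.bidual_apply_le P (hdot hξ))
      have h2 := mul_le_mul_of_nonneg_right hPc (hdot hξ 1 h.one_nonneg)
      rw [arensFDot_apply, hone] at h1 h2
      exact h1.trans h2)
    ξ hξ
  rw [smul_apply, smul_eq_mul, inv_mul_le_iff₀ hcpos] at hle
  refine le_antisymm (by simpa using hle) (hP _ (hdot hξ))

theorem isCompact_states (h : IsOrderUnitAlgebra Z) : IsCompact (states Z) := by
  refine (WeakDual.isCompact_closedBall (𝕜 := ℝ) (E := Z) 0 1).of_isClosed_subset ?_ ?_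
  · have : states Z = (⋂ a : Z, ⋂ _ : 0 ≤ a, {φ : WeakDual ℝ Z | 0 ≤ φ a}) ∩ {φ | φ 1 = 1} := by
      ext φ; simp [states]
    rw [this]
    refine (isClosed_iInter fun a => isClosed_iInter fun _ => ?_).inter ?_
    · exact isClosed_le continuous_const (WeakDual.eval_continuous a)
    · exact isClosed_eq (WeakDual.eval_continuous 1) continuous_const
  · rintro φ ⟨hφ, hφ1⟩
    have := h.norm_le_apply_one (ξ := WeakDual.toStrongDual φ) hφ
    simpa [hφ1] using this

variable [PosSMulMono ℝ Z]

/-- Every functional is dominated by a positive functional of no larger norm. -/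
theorem exists_dualNonneg_ge (h : IsOrderUnitAlgebra Z) (ξ : Z →L[ℝ] ℝ) :
    ∃ η : Z →L[ℝ] ℝ, dualNonneg η ∧ dualNonneg (η - ξ) ∧ ‖η‖ ≤ ‖ξ‖ := by
  obtain ⟨K, hK⟩ := exists_linearMap_le_of_cone
    (fun (a : Z) (v : ℝ) => ∃ r : ℝ, 0 ≤ r ∧ ∃ c : Z, 0 ≤ c ∧ a + c ≤ r • (1 : Z) ∧
      v = r * ‖ξ‖ - ξ c)
    (by
      rintro a b _ _ ⟨r, hr, c, hc, hac, rfl⟩ ⟨t, ht, d, hd, hbd, rfl⟩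
      refine ⟨r + t, add_nonneg hr ht, c + d, add_nonneg hc hd, ?_, ?_⟩
      · rw [add_smul, add_add_add_comm]
        exact add_le_add hac hbd
      · rw [map_add]; ring)
    (by
      rintro s hs a _ ⟨r, hr, c, hc, hac, rfl⟩
      refine ⟨s * r, mul_nonneg hs.le hr, s • c, smul_nonneg hs.le hc, ?_, ?_⟩
      · rw [← smul_add, mul_smul]
        exact smul_le_smul_of_nonneg_left hac hs.le
      · rw [map_smul, smul_eq_mul]; ring)
    (fun a => ⟨_, ‖a‖, norm_nonneg a, 0, le_rfl, by simpa using h.le_norm_smul_one a, rfl⟩)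
    (by
      rintro _ ⟨r, hr, c, hc, hac, rfl⟩
      rw [zero_add] at hac
      have hcr : ‖c‖ ≤ r := (h.norm_le_iff c r hr).2
        ⟨(neg_nonpos.2 (smul_nonneg hr h.one_nonneg)).trans hc, hac⟩
      have := (le_abs_self _).trans (ξ.le_opNorm c)
      nlinarith [norm_nonneg ξ])
  have hnorm : ∀ a, K a ≤ ‖ξ‖ * ‖a‖ := fun a =>
    hK a _ ⟨‖a‖, norm_nonneg a, 0, le_rfl, by simpa using h.le_norm_smul_one a, by
      rw [map_zero, sub_zero, mul_comm]⟩
  have hnorm' : ∀ a, ‖K a‖ ≤ ‖ξ‖ * ‖a‖ := fun a => by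
    rw [Real.norm_eq_abs, abs_le']
    exact ⟨hnorm a, by simpa using hnorm (-a)⟩
  refine ⟨K.mkContinuous _ hnorm', fun a ha => ?_, fun a ha => ?_,
    K.mkContinuous_norm_le (norm_nonneg ξ) hnorm'⟩
  · have := hK (-a) 0 ⟨0, le_rfl, 0, le_rfl, by simpa using ha, by simp⟩
    simpa using this
  · have := hK (-a) (-ξ a) ⟨0, le_rfl, a, ha, by simp, by simp⟩
    simpa using this

/-- A downward directed set of elements of the bidual with infimum `0` tends pointwise to `0` on
positive functionals. -/
theorem nonpos_of_bidualDownTo0 (h : IsOrderUnitAlgebra Z)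
    {s : Set ((Z →L[ℝ] ℝ) →L[ℝ] ℝ)} (hs : BidualDownTo0 s) {ξ : Z →L[ℝ] ℝ} (hξ : dualNonneg ξ)
    {k : ℝ} (hk : ∀ F ∈ s, k ≤ F ξ) : k ≤ 0 := by
  obtain ⟨⟨F₀, hF₀⟩, hdir, hpos, hinf⟩ := hs
  have hmono : ∀ F ∈ s, ∀ α β : Z →L[ℝ] ℝ, dualNonneg (β - α) → F α ≤ F β := fun F hF α β hαβ => by
    have := hpos F hF _ hαβ
    simpa using this
  obtain ⟨K, hK⟩ := exists_linearMap_le_of_cone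
    (fun (ζ : Z →L[ℝ] ℝ) (r : ℝ) => ∃ t : ℝ, 0 ≤ t ∧ ∃ F ∈ s, ∃ α : Z →L[ℝ] ℝ, dualNonneg α ∧
      dualNonneg (α - (ζ + t • ξ)) ∧ F α ≤ r + t * k)
    (by
      rintro ζ ζ' r r' ⟨t, ht, F, hF, α, hα, hαζ, hr⟩ ⟨t', ht', F', hF', α', hα', hαζ', hr'⟩
      obtain ⟨G, hG, hGF, hGF'⟩ := hdir F hF F' hF'
      refine ⟨t + t', add_nonneg ht ht', G, hG, α + α',
        fun a ha => add_nonneg (hα a ha) (hα' a ha), fun a ha => ?_, ?_⟩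
      · have h1 := hαζ a ha
        have h2 := hαζ' a ha
        simp only [sub_apply, add_apply,
          smul_apply, smul_eq_mul] at h1 h2 ⊢
        linarith
      · rw [map_add]
        linarith [hGF α hα, hGF' α' hα'])
    (by
      rintro c hc ζ r ⟨t, ht, F, hF, α, hα, hαζ, hr⟩
      refine ⟨c * t, mul_nonneg hc.le ht, F, hF, c • α,
        fun a ha => mul_nonneg hc.le (hα a ha), fun a ha => ?_, ?_⟩
      · have h1 := mul_nonneg hc.le (hαζ a ha)
        simp only [sub_apply, add_apply,
          smul_apply, smul_eq_mul] at h1 ⊢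
        linarith
      · rw [map_smul, smul_eq_mul]
        nlinarith)
    (fun ζ => by
      obtain ⟨η, hη, hηζ, -⟩ := h.exists_dualNonneg_ge ζ
      exact ⟨F₀ η, 0, le_rfl, F₀, hF₀, η, hη, by simpa using hηζ, by simp⟩)
    (by
      rintro r ⟨t, ht, F, hF, α, hα, hαζ, hr⟩
      have := hmono F hF _ _ hαζ
      simp only [zero_add, map_smul, smul_eq_mul] at this
      nlinarith [hk F hF])
  have hnorm : ∀ ζ, K ζ ≤ ‖F₀‖ * ‖ζ‖ := fun ζ => by
    obtain ⟨η, hη, hηζ, hn⟩ := h.exists_dualNonneg_ge ζ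
    refine (hK ζ (F₀ η) ⟨0, le_rfl, F₀, hF₀, η, hη, by simpa using hηζ, by simp⟩).trans ?_
    exact ((le_abs_self _).trans (F₀.le_opNorm η)).trans
      (mul_le_mul_of_nonneg_left hn (norm_nonneg _))
  have hnorm' : ∀ ζ, ‖K ζ‖ ≤ ‖F₀‖ * ‖ζ‖ := fun ζ => by
    rw [Real.norm_eq_abs, abs_le']
    exact ⟨hnorm ζ, by simpa using hnorm (-ζ)⟩
  have hle := hinf (K.mkContinuous _ hnorm') (fun F hF α hα =>
    hK α (F α) ⟨0, le_rfl, F, hF, α, hα, fun a _ => by simp, by simp⟩) ξ hξ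
  have hge := hK (-ξ) (-k) ⟨1, zero_le_one, F₀, hF₀, 0, fun a _ => by simp, fun a _ => by simp,
    by simp⟩
  simp only [LinearMap.mkContinuous_apply, zero_apply, map_neg] at hle hge
  linarith

/-- Pure states are multiplicative. -/
theorem map_mul_of_mem_extremePoints (h : IsOrderUnitAlgebra Z) {φ : WeakDual ℝ Z}
    (hφ : φ ∈ (states Z).extremePoints ℝ) (a b : Z) : φ (a * b) = φ a * φ b := by
  obtain ⟨⟨hpos, hone⟩, hext⟩ := hφ
  have hmono : ∀ {a b : Z}, a ≤ b → φ a ≤ φ b := dualNonneg.mono (ξ := WeakDual.toStrongDual φ) hpos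
  have hstate : ∀ a : Z, 0 ≤ a → 0 < φ a →
      ((φ a)⁻¹ • (StrongDual.toWeakDual (arensDot Z (WeakDual.toStrongDual φ) a))) ∈ states Z := by
    refine fun a ha hφa => ⟨fun b hb => ?_, ?_⟩
    · exact mul_nonneg (inv_nonneg.2 hφa.le) (hpos _ (h.nonneg_mul a b ha hb))
    · change (φ a)⁻¹ * φ (a * 1) = 1
      rw [mul_one, inv_mul_cancel₀ hφa.ne']
  have key : ∀ a : Z, 0 ≤ a → 0 ≤ 1 - a → 0 < φ a → 0 < φ (1 - a) → φ (a * b) = φ a * φ b := by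
    intro a ha ha' hφa hφa'
    have hsum : φ a + φ (1 - a) = 1 := by rw [← map_add, add_sub_cancel, hone]
    have := hext (hstate a ha hφa) (hstate _ ha' hφa') ⟨φ a, φ (1 - a), hφa, hφa', hsum, by
      rw [smul_inv_smul₀ hφa.ne', smul_inv_smul₀ hφa'.ne']
      refine DFunLike.ext _ _ fun c => ?_
      change φ (a * c) + φ ((1 - a) * c) = φ c
      rw [← map_add, ← add_mul, add_sub_cancel, one_mul]⟩
    have hb : (φ a)⁻¹ * φ (a * b) = φ b := DFunLike.congr_fun this b
    rw [← hb, mul_inv_cancel_left₀ hφa.ne']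
  have hr : (0 : ℝ) < ‖a‖ + 1 := by positivity
  have h1 : a ≤ (‖a‖ + 1) • (1 : Z) := by
    rw [add_smul, one_smul]
    exact (h.le_norm_smul_one a).trans (le_add_of_nonneg_right h.one_nonneg)
  have h2 : -((‖a‖ + 1) • (1 : Z)) ≤ a := by
    refine le_trans (neg_le_neg ?_) (h.neg_norm_smul_one_le a)
    rw [add_smul, one_smul]
    exact le_add_of_nonneg_right h.one_nonneg
  have h3 := hmono h1
  have h4 := hmono h2
  simp only [map_neg, map_smul, smul_eq_mul, hone, mul_one] at h3 h4
  have hr4 : (0 : ℝ) ≤ (4 * (‖a‖ + 1))⁻¹ := by positivity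
  have h5 := key ((4 * (‖a‖ + 1))⁻¹ • (a + (2 * (‖a‖ + 1)) • (1 : Z)))
    (smul_nonneg hr4 (by
      have : (2 * (‖a‖ + 1)) • (1 : Z) = (‖a‖ + 1) • (1 : Z) + (‖a‖ + 1) • (1 : Z) := by
        rw [two_mul, add_smul]
      rw [this, ← add_assoc]
      exact add_nonneg (by rwa [← neg_le_iff_add_nonneg]) (smul_nonneg hr.le h.one_nonneg)))
    (by
      have : (1 : Z) - (4 * (‖a‖ + 1))⁻¹ • (a + (2 * (‖a‖ + 1)) • (1 : Z)) =
          (4 * (‖a‖ + 1))⁻¹ • (((‖a‖ + 1) • (1 : Z) - a) + (‖a‖ + 1) • (1 : Z)) := by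
        match_scalars
        · field_simp
          ring
        · field_simp
      rw [this]
      exact smul_nonneg hr4 (add_nonneg (sub_nonneg.2 h1) (smul_nonneg hr.le h.one_nonneg)))
    (by
      simp only [map_smul, map_add, smul_eq_mul, hone]
      exact mul_pos (by positivity) (by linarith))
    (by
      simp only [map_sub, map_smul, map_add, smul_eq_mul, hone, sub_pos]
      rw [inv_mul_lt_iff₀ (by positivity)]
      linarith)
  simp only [smul_mul_assoc, add_mul, one_mul, map_smul, map_add, smul_eq_mul, hone] at h5
  field_simp at h5
  linarith

/-- An order unit algebra whose points are separated by positive functionals is commutative. -/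
theorem mul_comm_of_separating (h : IsOrderUnitAlgebra Z)
    (hsep : ∀ a : Z, (∀ ξ : Z →L[ℝ] ℝ, dualNonneg ξ → ξ a = 0) → a = 0) (a b : Z) :
    a * b = b * a := by
  have : LocallyConvexSpace ℝ (WeakDual ℝ Z) :=
    inferInstanceAs (LocallyConvexSpace ℝ (WeakBilin (topDualPairing ℝ Z)))
  rw [← sub_eq_zero]
  refine hsep _ fun ξ hξ => ?_
  have hstates : ∀ φ ∈ states Z, φ (a * b - b * a) = 0 := by
    have hsub : closure (convexHull ℝ ((states Z).extremePoints ℝ)) ⊆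
        {φ : WeakDual ℝ Z | φ (a * b - b * a) = 0} := by
      refine closure_minimal (convexHull_min (fun φ hφ => ?_) ?_) ?_
      · change φ _ = 0
        rw [map_sub, h.map_mul_of_mem_extremePoints hφ, h.map_mul_of_mem_extremePoints hφ,
          mul_comm, sub_self]
      · intro φ hφ ψ hψ s t _ _ _
        change s * φ _ + t * ψ _ = 0
        rw [Set.mem_ofPred_eq] at hφ hψ
        rw [hφ, hψ, mul_zero, mul_zero, add_zero]
      · exact isClosed_eq (WeakDual.eval_continuous _) continuous_const
    rw [closure_convexHull_extremePoints h.isCompact_states convex_states] at hsub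
    exact fun φ hφ => hsub hφ
  rcases (hξ 1 h.one_nonneg).eq_or_lt with h1 | h1
  · have hn := h.norm_le_apply_one hξ
    rw [← h1, norm_le_zero_iff] at hn
    rw [hn, zero_apply]
  · have h2 : (ξ 1)⁻¹ * ξ (a * b - b * a) = 0 :=
      hstates (StrongDual.toWeakDual ((ξ 1)⁻¹ • ξ))
        ⟨fun c hc => mul_nonneg (inv_nonneg.2 h1.le) (hξ c hc), inv_mul_cancel₀ h1.ne'⟩
    exact (mul_eq_zero.1 h2).resolve_left (inv_ne_zero h1.ne')

end IsOrderUnitAlgebra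

section LatticeGroup

variable {G : Type*} [Lattice G] [AddCommGroup G] [IsOrderedAddMonoid G]

theorem add_inf_eq_zero {a b c : G} (ha : 0 ≤ a) (hb : 0 ≤ b) (hc : 0 ≤ c) (hab : a ⊓ b = 0)
    (hcb : c ⊓ b = 0) : (a + c) ⊓ b = 0 := by
  refine le_antisymm ?_ (le_inf (add_nonneg ha hc) hb)
  rw [← hcb]
  refine le_inf ?_ inf_le_right
  rw [← sub_nonpos, ← hab]
  exact le_inf (sub_le_iff_le_add.2 inf_le_left)
    ((sub_le_self _ hc).trans inf_le_right)

theorem nsmul_inf_eq_zero {a b : G} (ha : 0 ≤ a) (hb : 0 ≤ b) (hab : a ⊓ b = 0) (n : ℕ) :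
    (n • a) ⊓ b = 0 := by
  induction n with
  | zero => simpa using hb
  | succ n ih =>
    rw [succ_nsmul]
    exact add_inf_eq_zero (nsmul_nonneg ha n) hb ha ih hab

/-- A positive element which lies below the range of a positive band preserving operator and in
its kernel is infinitesimal. -/
theorem nsmul_le_of_isBandPres {T : G →+ G} (hT : IsBandPres T) (hpos : ∀ x, 0 ≤ x → 0 ≤ T x)
    {f h : G} (hf : 0 ≤ f) (hh : 0 ≤ h) (hle : h ≤ T f) (hTh : T h = 0) (n : ℕ) : n • h ≤ f := by
  have hdisj : |T (f - n • h)⁺| ⊓ (f - n • h)⁻ = 0 := by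
    have := hT (f - n • h)⁺ (f - n • h)⁻ (by
      rw [abs_of_nonneg (posPart_nonneg _), abs_of_nonneg (negPart_nonneg _),
        posPart_inf_negPart_eq_zero])
    rwa [abs_of_nonneg (negPart_nonneg _)] at this
  have hhT : h ≤ |T (f - n • h)⁺| := by
    have h1 : T f = T (f - n • h)⁺ - T (f - n • h)⁻ := by
      rw [← map_sub, posPart_sub_negPart, map_sub, map_nsmul, hTh, smul_zero, sub_zero]
    refine hle.trans (le_trans ?_ (le_abs_self _))
    rw [h1]
    exact sub_le_self _ (hpos _ (negPart_nonneg _))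
  have hinf : h ⊓ (f - n • h)⁻ = 0 :=
    le_antisymm (hdisj ▸ inf_le_inf_right _ hhT) (le_inf hh (negPart_nonneg _))
  have hneg : (f - n • h)⁻ ≤ n • h := by
    rw [negPart_def]
    exact sup_le (by simpa using hf) (nsmul_nonneg hh n)
  have := nsmul_inf_eq_zero hh (negPart_nonneg _) hinf n
  rw [inf_eq_right.2 hneg, negPart_eq_zero] at this
  exact sub_nonneg.1 this

variable [Module ℝ G] [PosSMulMono ℝ G]

theorem isCentral_of_bounds (T : G →ₗ[ℝ] G) (c : ℝ)
    (hT : ∀ x, 0 ≤ x → -(c • x) ≤ T x ∧ T x ≤ c • x) : IsCentral T := by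
  obtain ⟨n, hn⟩ := exists_nat_ge c
  have hn' : ∀ x : G, 0 ≤ x → c • x ≤ n • x := fun x hx => by
    rw [← Nat.cast_smul_eq_nsmul ℝ, ← sub_nonneg, ← sub_smul]
    exact smul_nonneg (sub_nonneg.2 hn) hx
  refine ⟨⟨T.isLinear, fun a b => ?_, fun x y hxy => ?_⟩, c, hT⟩
  · refine ⟨-(n • (b - a)) + T a, n • (b - a) + T a, fun x hax hxb => ?_⟩
    obtain ⟨h1, h2⟩ := hT (x - a) (sub_nonneg.2 hax)
    have h3 := (hn' (x - a) (sub_nonneg.2 hax)).trans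
      (nsmul_le_nsmul_right (sub_le_sub_right hxb a) n)
    rw [map_sub] at h1 h2
    exact ⟨le_sub_iff_add_le.1 ((neg_le_neg h3).trans h1), sub_le_iff_le_add.1 (h2.trans h3)⟩
  · refine le_antisymm ?_ (le_inf (abs_nonneg _) (abs_nonneg _))
    have hle : |T x| ≤ n • |x| := by
      have h1 := hT _ (posPart_nonneg x)
      have h2 := hT _ (negPart_nonneg x)
      have hx : T x = T x⁺ - T x⁻ := by rw [← map_sub, posPart_sub_negPart]
      refine le_trans ?_ (hn' _ (abs_nonneg x))
      rw [hx, ← posPart_add_negPart x, smul_add, abs_le']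
      refine ⟨?_, ?_⟩
      · rw [sub_eq_add_neg]
        exact add_le_add h1.2 (neg_le.1 h2.1)
      · rw [neg_sub, sub_eq_add_neg, add_comm]
        exact add_le_add (neg_le.1 h1.1) h2.2
    rw [← nsmul_inf_eq_zero (abs_nonneg x) (abs_nonneg y) hxy n]
    exact inf_le_inf_right _ hle

end LatticeGroup

namespace IsCenterOf

variable {E Z : Type*} [Lattice E] [AddCommGroup E] [Module ℝ E]
  [Lattice Z] [NormedRing Z] [NormedAlgebra ℝ Z] {ρ : Z → E → E}

theorem map_add (hZ : IsCenterOf E Z ρ) (a b : Z) (x : E) : ρ (a + b) x = ρ a x + ρ b x :=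
  (hZ.lin_vec x).map_add a b

theorem map_smul (hZ : IsCenterOf E Z ρ) (c : ℝ) (a : Z) (x : E) : ρ (c • a) x = c • ρ a x :=
  (hZ.lin_vec x).map_smul c a

theorem map_zero (hZ : IsCenterOf E Z ρ) (x : E) : ρ 0 x = 0 :=
  (hZ.lin_vec x).map_zero

theorem map_neg (hZ : IsCenterOf E Z ρ) (a : Z) (x : E) : ρ (-a) x = -ρ a x :=
  (hZ.lin_vec x).map_neg a

theorem isLinearMap (hZ : IsCenterOf E Z ρ) (a : Z) : IsLinearMap ℝ (ρ a) := (hZ.central a).1.1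

theorem apply_nonneg (hZ : IsCenterOf E Z ρ) {a : Z} (ha : 0 ≤ a) {x : E} (hx : 0 ≤ x) :
    0 ≤ ρ a x := by
  simpa [hZ.map_zero] using (hZ.le_iff 0 a).1 ha x hx

theorem isOrderUnitAlgebra (hZ : IsCenterOf E Z ρ) : IsOrderUnitAlgebra Z where
  norm_le_iff a c hc := by
    simp only [hZ.norm_le_iff a c hc, hZ.le_iff, hZ.map_neg, hZ.map_smul, hZ.map_one, forall_and]
  nonneg_mul a b ha hb := (hZ.le_iff _ _).2 fun x hx => by
    rw [hZ.map_zero, hZ.map_mul]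
    exact hZ.apply_nonneg ha (hZ.apply_nonneg hb hx)
  one_nonneg := (hZ.le_iff _ _).2 fun x hx => by rwa [hZ.map_zero, hZ.map_one]

end IsCenterOf

section ArensHom

variable {E D Z : Type*}
  [Lattice E] [AddCommGroup E] [Module ℝ E]
  [Lattice D] [AddCommGroup D] [Module ℝ D]
  [Lattice Z] [NormedRing Z] [NormedAlgebra ℝ Z]
  {p : D → E → ℝ} {ρ : Z → E → E}

theorem IsOrderDual.ext_of_nonneg (hD : IsOrderDual E D p) {f g : D}
    (h : ∀ x, 0 ≤ x → p f x = p g x) : f = g :=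
  le_antisymm ((hD.le_iff _ _).2 fun x hx => (h x hx).le)
    ((hD.le_iff _ _).2 fun x hx => (h x hx).ge)

theorem IsOrderDual.nonneg_iff (hD : IsOrderDual E D p) {f : D} :
    0 ≤ f ↔ ∀ x, 0 ≤ x → 0 ≤ p f x := by
  simp [hD.le_iff, (hD.lin_vec _).map_zero]

/-- The order dual is Archimedean. -/
theorem IsOrderDual.nonpos_of_nsmul_le (hD : IsOrderDual E D p) {f h : D}
    (hle : ∀ n : ℕ, n • h ≤ f) : h ≤ 0 := by
  refine (hD.le_iff _ _).2 fun x hx => ?_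
  rw [(hD.lin_vec x).map_zero]
  by_contra! hpos
  obtain ⟨n, hn⟩ := exists_nat_gt (p f x / p h x)
  have h1 := (hD.le_iff _ _).1 (hle n) x hx
  rw [← Nat.cast_smul_eq_nsmul ℝ, (hD.lin_vec x).map_smul, smul_eq_mul] at h1
  rw [div_lt_iff₀ hpos] at hn
  linarith

variable [IsOrderedAddMonoid E]

theorem exists_evalFunctional (hD : IsOrderDual E D p) (hZ : IsCenterOf E Z ρ) (f : D) (x : E) :
    ∃ μ : Z →L[ℝ] ℝ, ∀ T, μ T = p f (ρ T x) := by
  let L : Z →ₗ[ℝ] ℝ := (hD.lin_fun f).mk'.comp (hZ.lin_vec x).mk'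
  obtain ⟨c, d, hcd⟩ := hD.bdd f (-|x|) |x|
  obtain ⟨C, hC⟩ := L.bound_of_ball_bound zero_lt_one (|c| + |d|) fun T hT => by
    have hT1 : ‖T‖ ≤ 1 := by simpa using (mem_ball_zero_iff.1 hT).le
    have hb := (hZ.norm_le_iff T 1 zero_le_one).1 hT1
    simp only [one_smul] at hb
    have h1 := hb _ (posPart_nonneg x)
    have h2 := hb _ (negPart_nonneg x)
    have hx : ρ T x = ρ T x⁺ - ρ T x⁻ := by
      rw [← (hZ.isLinearMap T).map_sub, posPart_sub_negPart]
    have hLT : L T = p f (ρ T x) := rfl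
    obtain ⟨h3, h4⟩ := hcd (ρ T x)
      (by
        rw [hx, ← posPart_add_negPart x, neg_add, sub_eq_add_neg]
        exact add_le_add h1.1 (neg_le_neg h2.2))
      (by
        rw [hx, ← posPart_add_negPart x, sub_eq_add_neg]
        exact add_le_add h1.2 (neg_le.1 h2.1))
    rw [hLT, Real.norm_eq_abs, abs_le]
    constructor
    · linarith [neg_abs_le c, abs_nonneg d]
    · linarith [le_abs_self d, abs_nonneg c]
  exact ⟨L.mkContinuous C hC, fun T => rfl⟩

/-- The functional `μ_{x,f} : T ↦ f (T x)` on the center. -/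
noncomputable def evalFunctional (hD : IsOrderDual E D p) (hZ : IsCenterOf E Z ρ) (f : D) (x : E) :
    Z →L[ℝ] ℝ :=
  (exists_evalFunctional hD hZ f x).choose

variable (hD : IsOrderDual E D p) (hZ : IsCenterOf E Z ρ)

@[simp] theorem evalFunctional_apply (f : D) (x : E) (T : Z) :
    evalFunctional hD hZ f x T = p f (ρ T x) :=
  (exists_evalFunctional hD hZ f x).choose_spec T

theorem dualNonneg_evalFunctional {f : D} (hf : 0 ≤ f) {x : E} (hx : 0 ≤ x) :
    dualNonneg (evalFunctional hD hZ f x) := fun T hT => by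
  rw [evalFunctional_apply]
  exact hD.nonneg_iff.1 hf _ (hZ.apply_nonneg hT hx)

theorem evalFunctional_add (f g : D) (x : E) :
    evalFunctional hD hZ (f + g) x = evalFunctional hD hZ f x + evalFunctional hD hZ g x := by
  ext T
  simp [(hD.lin_vec _).map_add]

theorem evalFunctional_smul (c : ℝ) (f : D) (x : E) :
    evalFunctional hD hZ (c • f) x = c • evalFunctional hD hZ f x := by
  ext T
  simp [(hD.lin_vec _).map_smul]

end ArensHom

/-- Multiplication in the center of a Riesz space with separating order dual is commutative. -/
theorem IsCenterOf.mul_comm {E D Z : Type*}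
    [Lattice E] [AddCommGroup E] [Module ℝ E] [IsOrderedAddMonoid E]
    [Lattice D] [AddCommGroup D] [Module ℝ D] [IsOrderedAddMonoid D]
    [Lattice Z] [NormedRing Z] [NormedAlgebra ℝ Z] [IsOrderedAddMonoid Z] [PosSMulMono ℝ Z]
    {p : D → E → ℝ} {ρ : Z → E → E} (hD : IsOrderDual E D p) (hZ : IsCenterOf E Z ρ)
    (hsep : SepPoints p)
    (a b : Z) : a * b = b * a := by
  refine hZ.isOrderUnitAlgebra.mul_comm_of_separating (fun c hc => ?_) a b
  have hpos : ∀ x, 0 ≤ x → ρ c x = 0 := fun x hx => hsep _ fun f => by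
    have h1 := hc _ (dualNonneg_evalFunctional hD hZ (posPart_nonneg f) hx)
    have h2 := hc _ (dualNonneg_evalFunctional hD hZ (negPart_nonneg f) hx)
    rw [evalFunctional_apply] at h1 h2
    rw [← posPart_sub_negPart f, (hD.lin_vec _).map_sub, h1, h2, sub_zero]
  refine hZ.inj _ _ fun x => ?_
  rw [hZ.map_zero, ← posPart_sub_negPart x, (hZ.isLinearMap c).map_sub,
    hpos _ (posPart_nonneg x), hpos _ (negPart_nonneg x), sub_zero]

/-- Proposition 3.  Let `E` be a Riesz space with point separating order
dual `E^∼` (realized as `D`), and let `Z` (with its order unit norm) realize the ideal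
center `Z(E)`.  The Arens homomorphism `m : Z(E)'' → L_b(E^∼)`,
`m(F)(f)(x) = F(μ_{x,f})` with `μ_{x,f}(T) = f(Tx)`, is a unital algebra homomorphism and
an order continuous lattice homomorphism whose range is contained in the ideal center
`Z(E^∼)`. -/
theorem statement2
    {E D Z : Type*}
    [Lattice E] [AddCommGroup E] [Module ℝ E]
    [CovariantClass E E (· + ·) (· ≤ ·)] [PosSMulMono ℝ E]
    [Lattice D] [AddCommGroup D] [Module ℝ D]
    [CovariantClass D D (· + ·) (· ≤ ·)] [PosSMulMono ℝ D]
    [Lattice Z] [NormedRing Z] [NormedAlgebra ℝ Z]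
    [CovariantClass Z Z (· + ·) (· ≤ ·)] [PosSMulMono ℝ Z]
    (pE : D → E → ℝ) (hD : IsOrderDual E D pE) (hsep : SepPoints pE)
    (ρ : Z → E → E) (hZ : IsCenterOf E Z ρ)
    (m : ((Z →L[ℝ] ℝ) →L[ℝ] ℝ) → D → D)
    (hm : ∀ (F : (Z →L[ℝ] ℝ) →L[ℝ] ℝ) (f : D) (x : E) (μ : Z →L[ℝ] ℝ),
      (∀ T : Z, μ T = pE f (ρ T x)) → pE (m F f) x = F μ) :
    -- the range of `m` is contained in `Z(E^∼)`
    (∀ F : (Z →L[ℝ] ℝ) →L[ℝ] ℝ, IsCentral (m F)) ∧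
    -- `m` is linear
    (∀ f : D, IsLinearMap ℝ fun F => m F f) ∧
    -- `m` is unital
    (∀ f : D, m (arensOne Z) f = f) ∧
    -- `m` is an algebra homomorphism for the Arens product on `Z''`
    (∀ (F G : (Z →L[ℝ] ℝ) →L[ℝ] ℝ) (f : D), m (arensMul Z F G) f = m F (m G f)) ∧
    -- `m` is a lattice homomorphism (lattice operations of central operators are
    -- pointwise on positive elements)
    (∀ F G H : (Z →L[ℝ] ℝ) →L[ℝ] ℝ, IsBidualSup F G H →
      ∀ f : D, 0 ≤ f → m H f = m F f ⊔ m G f) ∧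
    -- `m` is order continuous
    (∀ s : Set ((Z →L[ℝ] ℝ) →L[ℝ] ℝ), BidualDownTo0 s →
      ∀ f : D, 0 ≤ f → IsGLB ((fun F => m F f) '' s) 0) := by
  have : IsOrderedAddMonoid E := { add_le_add_left := fun a b hab c => by gcongr }
  have : IsOrderedAddMonoid D := { add_le_add_left := fun a b hab c => by gcongr }
  have : IsOrderedAddMonoid Z := { add_le_add_left := fun a b hab c => by gcongr }
  have hA := hZ.isOrderUnitAlgebra
  have hm' : ∀ F f x, pE (m F f) x = F (evalFunctional hD hZ f x) := fun F f x =>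
    hm F f x _ (evalFunctional_apply hD hZ f x)
  have hlin : ∀ F, IsLinearMap ℝ (m F) := fun F =>
    ⟨fun f g => hD.inj _ _ fun x => by
      rw [hm', (hD.lin_vec x).map_add, hm', hm', evalFunctional_add, map_add],
    fun c f => hD.inj _ _ fun x => by
      rw [hm', (hD.lin_vec x).map_smul, hm', evalFunctional_smul, map_smul]⟩
  have hcentral : ∀ F, IsCentral (m F) := fun F => by
    refine isCentral_of_bounds (hlin F).mk' ‖F‖ fun f hf => ?_
    have hb : ∀ x, 0 ≤ x → |pE (m F f) x| ≤ ‖F‖ * pE f x := fun x hx => by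
      have := hA.bidual_apply_le F (dualNonneg_evalFunctional hD hZ hf hx)
      rwa [evalFunctional_apply, hZ.map_one, ← hm'] at this
    refine ⟨(hD.le_iff _ _).2 fun x hx => ?_, (hD.le_iff _ _).2 fun x hx => ?_⟩
    · rw [(hD.lin_vec x).map_neg, (hD.lin_vec x).map_smul]
      exact (abs_le.1 (hb x hx)).1
    · rw [(hD.lin_vec x).map_smul]
      exact (abs_le.1 (hb x hx)).2
  have hmul : ∀ F G f, m (arensMul Z F G) f = m F (m G f) := fun F G f => hD.inj _ _ fun x => by
    rw [hm', hm', arensMul_apply_apply]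
    congr 1
    ext T
    rw [arensFDot_apply, evalFunctional_apply, hm']
    congr 1
    ext S
    rw [arensDot_apply, evalFunctional_apply, evalFunctional_apply,
      IsCenterOf.mul_comm hD hZ hsep, hZ.map_mul]
  have hle : ∀ F G, bidualLe F G → ∀ f, 0 ≤ f → m F f ≤ m G f := fun F G hFG f hf =>
    (hD.le_iff _ _).2 fun x hx => by
      rw [hm', hm']
      exact hFG _ (dualNonneg_evalFunctional hD hZ hf hx)
  have hlinF : ∀ f, IsLinearMap ℝ fun F => m F f := fun f =>
    ⟨fun F G => hD.inj _ _ fun x => by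
      rw [hm', (hD.lin_vec x).map_add, hm', hm', add_apply],
    fun c F => hD.inj _ _ fun x => by
      rw [hm', (hD.lin_vec x).map_smul, hm', smul_apply]⟩
  have hnonneg : ∀ F, bidualLe 0 F → ∀ f, 0 ≤ f → 0 ≤ m F f := fun F hF f hf => by
    have := hle 0 F hF f hf
    rwa [(hlinF f).map_zero] at this
  have hdisj : ∀ P Q, bidualLe 0 P → bidualLe 0 Q →
      (∀ K, bidualLe K P → bidualLe K Q → bidualLe K 0) → ∀ f, 0 ≤ f → m P f ⊓ m Q f = 0 := by
    intro P Q hP hQ hPQ f hf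
    have hprod : m P (m Q f) = 0 := hD.ext_of_nonneg fun x hx => by
      rw [← hmul, hm', (hD.lin_vec x).map_zero]
      exact hA.arensMul_apply_eq_zero hP hQ hPQ (dualNonneg_evalFunctional hD hZ hf hx)
    have hinf : 0 ≤ m P f ⊓ m Q f := le_inf (hnonneg P hP f hf) (hnonneg Q hQ f hf)
    have hker : m P (m P f ⊓ m Q f) = 0 := by
      refine le_antisymm ?_ (hnonneg P hP _ hinf)
      have := hnonneg P hP _ (sub_nonneg.2 (inf_le_right : m P f ⊓ m Q f ≤ m Q f))
      rwa [(hlin P).map_sub, hprod, sub_nonneg] at this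
    exact le_antisymm (hD.nonpos_of_nsmul_le fun n =>
      nsmul_le_of_isBandPres (T := (hlin P).mk'.toAddMonoidHom) (hcentral P).1.2.2
        (hnonneg P hP) hf hinf inf_le_left hker n) hinf
  refine ⟨hcentral, hlinF, fun f => hD.inj _ _ fun x => ?_, hmul, ?_, ?_⟩
  · rw [hm']
    change evalFunctional hD hZ f x 1 = _
    rw [evalFunctional_apply, hZ.map_one]
  · rintro F G H ⟨hF, hG, hH⟩ f hf
    have := hdisj (H - F) (H - G)
      (fun ξ hξ => by simpa using hF ξ hξ) (fun ξ hξ => by simpa using hG ξ hξ)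
      (fun K hKF hKG ξ hξ => by
        have := hH (H - K)
          (fun ζ hζ => by
            have := hKF ζ hζ
            rw [sub_apply] at this ⊢
            linarith)
          (fun ζ hζ => by
            have := hKG ζ hζ
            rw [sub_apply] at this ⊢
            linarith) ξ hξ
        simpa using this) f hf
    have hsub : ∀ F G, m (F - G) f = m F f - m G f := fun F G =>
      ((hlinF f).mk' _).map_sub F G
    rwa [hsub, hsub, ← sub_sup, sub_eq_zero] at this
  · intro s hs f hf
    refine ⟨?_, fun g hg => (hD.le_iff _ _).2 fun x hx => ?_⟩
    · rintro _ ⟨F, hF, rfl⟩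
      exact hnonneg F (hs.2.2.1 F hF) f hf
    · rw [(hD.lin_vec x).map_zero]
      refine hA.nonpos_of_bidualDownTo0 hs (dualNonneg_evalFunctional hD hZ hf hx) fun F hF => ?_
      rw [← hm']
      exact (hD.le_iff _ _).1 (hg ⟨F, hF, rfl⟩) x hx
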